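/- arXiv:1811.09981 — 2 statements merged into one kernel-verified Lean document; each statement's English description precedes it below -/
import Mathlib

section
/- Let A be an extremal d-dimensional (0,1)-matrix of order n with deficiency δ and let Λ be an optimal hyperplane cover of A. Then for any two entries λ_{i,j} and λ_{i,l} in the same row i of Λ, if λ_{i,j} ≠ λ_{i,l} then |λ_{i,j} − λ_{i,l}| ≥ δ. -/
open Finset

/-- A d-dimensional matrix of order n is a (0,1)-matrix if all entries are 0 or 1. -/
def IsZeroOne {d n : ℕ} (A : (Fin d → Fin n) → ℝ) : Prop :=
  ∀ α, A α = 0 ∨ A α = 1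

/-- A polyplex: nonnegative entries, each hyperplane sum at most 1. -/
def IsPolyplex {d n : ℕ} (K : (Fin d → Fin n) → ℝ) : Prop :=
  (∀ α, 0 ≤ K α) ∧
  ∀ (i : Fin d) (j : Fin n),
    (∑ α : Fin d → Fin n, if α i = j then K α else 0) ≤ 1

/-- The weight of a polyplex: the sum of all its entries. -/
def plexWeight {d n : ℕ} (K : (Fin d → Fin n) → ℝ) : ℝ := ∑ α, K α

/-- K is contained in A: supp(K) ⊆ supp(A). -/
def ContainedIn {d n : ℕ} (K A : (Fin d → Fin n) → ℝ) : Prop :=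
  ∀ α, K α ≠ 0 → A α ≠ 0

/-- The set of weights of polyplexes contained in A. -/
def polyplexWeights {d n : ℕ} (A : (Fin d → Fin n) → ℝ) : Set ℝ :=
  {W | ∃ K, IsPolyplex K ∧ ContainedIn K A ∧ plexWeight K = W}

/-- A contains a polydiagonal: a polyplex of weight n. -/
def HasPolydiagonal {d n : ℕ} (A : (Fin d → Fin n) → ℝ) : Prop :=
  ∃ K, IsPolyplex K ∧ ContainedIn K A ∧ plexWeight K = (n : ℝ)

/-- A is extremal: no polydiagonal, but changing any zero entry to 1 creates one. -/
def IsExtremal {d n : ℕ} (A : (Fin d → Fin n) → ℝ) : Prop :=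
  ¬ HasPolydiagonal A ∧
  ∀ α, A α = 0 → HasPolydiagonal (Function.update A α (1 : ℝ))

/-- A hyperplane cover of A: nonnegative weights on hyperplanes covering supp(A). -/
def IsCover {d n : ℕ} (A : (Fin d → Fin n) → ℝ) (Λ : Fin d → Fin n → ℝ) : Prop :=
  (∀ i j, 0 ≤ Λ i j) ∧ ∀ α, A α ≠ 0 → 1 ≤ ∑ i, Λ i (α i)

/-- The weight of a hyperplane cover. -/
def coverWeight {d n : ℕ} (Λ : Fin d → Fin n → ℝ) : ℝ := ∑ i, ∑ j, Λ i j

/-- The set of weights of hyperplane covers of A. -/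
def coverWeights {d n : ℕ} (A : (Fin d → Fin n) → ℝ) : Set ℝ :=
  {W | ∃ Λ : Fin d → Fin n → ℝ, IsCover A Λ ∧ coverWeight Λ = W}

/-- Λ is an optimal hyperplane cover of A. -/
def IsOptimalCover {d n : ℕ} (A : (Fin d → Fin n) → ℝ) (Λ : Fin d → Fin n → ℝ) : Prop :=
  IsCover A Λ ∧ ∀ Λ' : Fin d → Fin n → ℝ, IsCover A Λ' → coverWeight Λ ≤ coverWeight Λ'

/-- K is an optimal polyplex contained in A. -/
def IsOptimalPolyplex {d n : ℕ} (A K : (Fin d → Fin n) → ℝ) : Prop :=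
  IsPolyplex K ∧ ContainedIn K A ∧
  ∀ K' : (Fin d → Fin n) → ℝ, IsPolyplex K' → ContainedIn K' A → plexWeight K' ≤ plexWeight K

/-- A(Λ): the (0,1)-matrix of indices covered with weight at least 1 by Λ. -/
noncomputable def matOf {d n : ℕ} (Λ : Fin d → Fin n → ℝ) : (Fin d → Fin n) → ℝ :=
  fun α => if 1 ≤ ∑ i, Λ i (α i) then (1 : ℝ) else 0

/-- A has deficiency δ: the maximum weight of a polyplex contained in A is n − δ. -/
def HasDeficiency {d n : ℕ} (A : (Fin d → Fin n) → ℝ) (δ : ℝ) : Prop :=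
  IsGreatest (polyplexWeights A) ((n : ℝ) - δ)

/-- Every cover has weight at least that of a polyplex weighted by its coverage. -/
theorem sum_mul_cover_le_coverWeight {d n : ℕ} {K : (Fin d → Fin n) → ℝ} (hK : IsPolyplex K)
    {Λ : Fin d → Fin n → ℝ} (hΛ : ∀ i j, 0 ≤ Λ i j) :
    ∑ α, K α * ∑ i, Λ i (α i) ≤ coverWeight Λ := by
  have h : ∑ α, K α * ∑ i, Λ i (α i) =
      ∑ i, ∑ j, Λ i j * ∑ α : Fin d → Fin n, if α i = j then K α else 0 := by
    simp_rw [Finset.mul_sum]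
    rw [Finset.sum_comm]
    refine Finset.sum_congr rfl fun i _ => ?_
    rw [Finset.sum_comm]
    refine Finset.sum_congr rfl fun α _ => ?_
    simp [mul_comm]
  rw [h]
  exact Finset.sum_le_sum fun i _ => Finset.sum_le_sum fun j _ =>
    mul_le_of_le_one_right (hΛ i j) (hK.2 i j)

/-- The linear map sending a matrix to the table of its hyperplane sums. -/
def hyperplaneSums (d n : ℕ) : ((Fin d → Fin n) → ℝ) →ₗ[ℝ] (Fin d → Fin n → ℝ) where
  toFun K i j := ∑ α : Fin d → Fin n, if α i = j then K α else 0
  map_add' K K' := by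
    ext i j
    simp only [Pi.add_apply, ← Finset.sum_add_distrib]
    exact Finset.sum_congr rfl fun α _ => by split_ifs <;> simp
  map_smul' c K := by
    ext i j
    simp [Finset.mul_sum]

theorem hyperplaneSums_apply {d n : ℕ} (K : (Fin d → Fin n) → ℝ) (i : Fin d) (j : Fin n) :
    hyperplaneSums d n K i j = ∑ α : Fin d → Fin n, if α i = j then K α else 0 := rfl

/-- A linear functional on tables is given by its values on the unit tables. -/
theorem map_table_eq_sum {d n : ℕ} (f : (Fin d → Fin n → ℝ) →ₗ[ℝ] ℝ)
    (x : Fin d → Fin n → ℝ) :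
    f x = ∑ i, ∑ j, x i j * f (Pi.single i (Pi.single j 1)) := by
  have hx : x = ∑ i, ∑ j, x i j • (Pi.single i (Pi.single j 1) : Fin d → Fin n → ℝ) := by
    ext a b
    simp [Finset.sum_apply, Pi.single_apply, Finset.sum_ite_eq, ite_apply]
  conv_lhs => rw [hx]
  simp

/-- Strong duality: the weight of an optimal cover is attained by a polyplex. -/
theorem IsOptimalCover.coverWeight_mem_polyplexWeights {d n : ℕ} {A : (Fin d → Fin n) → ℝ}
    {Λ : Fin d → Fin n → ℝ} (hΛ : IsOptimalCover A Λ) :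
    coverWeight Λ ∈ polyplexWeights A := by
  set c := coverWeight Λ with hc
  have hc0 : 0 ≤ c := Finset.sum_nonneg fun i _ => Finset.sum_nonneg fun j _ => hΛ.1.1 i j
  by_contra hno
  let S : Set ((Fin d → Fin n) → ℝ) :=
    stdSimplex ℝ (Fin d → Fin n) ∩ {K | ∀ α, A α = 0 → K α = 0}
  have hSconv : Convex ℝ S := by
    refine (convex_stdSimplex ℝ _).inter ?_
    intro K hK K' hK' a b _ _ _ α hα
    simp [hK α hα, hK' α hα]
  have hScomp : IsCompact S := by
    refine (isCompact_stdSimplex ℝ _).inter_right ?_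
    simp only [Set.ofPred_forall]
    exact isClosed_iInter fun α => isClosed_iInter fun _ =>
      isClosed_eq (continuous_apply α) continuous_const
  let T := c • hyperplaneSums d n
  let D : Set (Fin d → Fin n → ℝ) := Set.Iic 1
  have hdisj : Disjoint (T '' S) D := by
    rw [Set.disjoint_left]
    rintro _ ⟨K, ⟨⟨hK0, hK1⟩, hKA⟩, rfl⟩ hD
    refine hno ⟨c • K, ⟨fun α => mul_nonneg hc0 (hK0 α), fun i j => ?_⟩, fun α h h0 => ?_, ?_⟩
    · have := hD i j
      rw [← hyperplaneSums_apply, map_smul]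
      exact this
    · exact h (by simp [hKA α h0])
    · simp [plexWeight, ← Finset.mul_sum, hK1]
  obtain ⟨f, u, v, hfu, huv, hvf⟩ := geometric_hahn_banach_compact_closed
    (hSconv.linear_image T) (hScomp.image T.continuous_of_finiteDimensional)
    (convex_Iic (1 : Fin d → Fin n → ℝ)) isClosed_Iic hdisj
  let g : Fin d → Fin n → ℝ := fun i j => f (Pi.single i (Pi.single j 1))
  have hf : ∀ x, f x = ∑ i, ∑ j, x i j * g i j := map_table_eq_sum f.toLinearMap
  have hg : ∀ i j, g i j ≤ 0 := by
    intro i j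
    by_contra! hpos
    have hu0 : v < 0 := by
      simpa using hvf 0 (fun _ _ => zero_le_one)
    have := hvf ((v / g i j) • Pi.single i (Pi.single j 1)) (by
      intro a b
      have hneg : v / g i j ≤ 0 := div_nonpos_of_nonpos_of_nonneg hu0.le hpos.le
      have h1 : (0 : ℝ) ≤ (Pi.single i (Pi.single j 1) : Fin d → Fin n → ℝ) a b := by
        simp only [Pi.single_apply, ite_apply, Pi.zero_apply]
        split_ifs <;> norm_num
      exact (mul_nonpos_of_nonpos_of_nonneg hneg h1).trans zero_le_one)
    rw [map_smul, smul_eq_mul, show f (Pi.single i (Pi.single j 1)) = g i j from rfl,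
      div_mul_cancel₀ _ hpos.ne'] at this
    exact lt_irrefl _ this
  have hsum : u < ∑ i, ∑ j, g i j := by
    have := hvf 1 Set.self_mem_Iic
    rw [hf] at this
    simp only [Pi.one_apply, one_mul] at this
    linarith
  have hu : u < 0 := hsum.trans_le
    (Finset.sum_nonpos fun i _ => Finset.sum_nonpos fun j _ => hg i j)
  have hcover : IsCover A fun i j => c / u * g i j := by
    refine ⟨fun i j => mul_nonneg_of_nonpos_of_nonpos
      (div_nonpos_of_nonneg_of_nonpos hc0 hu.le) (hg i j), fun α hα => ?_⟩
    have h := hfu _ ⟨Pi.single α 1, ⟨single_mem_stdSimplex ℝ α, fun β hβ =>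
      Pi.single_eq_of_ne (fun h => hα (by rwa [← h])) _⟩, rfl⟩
    have hT : f (T (Pi.single α 1)) = c * ∑ i, g i (α i) := by
      rw [hf, Finset.mul_sum]
      refine Finset.sum_congr rfl fun i _ => ?_
      have : ∀ j, T (Pi.single α 1) i j = if α i = j then c else 0 := by
        intro j
        simp only [T, LinearMap.smul_apply, Pi.smul_apply, hyperplaneSums_apply, smul_eq_mul]
        rw [Finset.sum_eq_single α (fun β _ hβ => by simp [hβ]) (by simp)]
        simp
      simp [this]
    rw [hT] at h
    rw [← Finset.mul_sum, div_mul_eq_mul_div, le_div_iff_of_neg hu]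
    linarith
  have hopt := hΛ.2 _ hcover
  have hw : coverWeight (fun i j => c / u * g i j) = c / u * ∑ i, ∑ j, g i j := by
    simp [coverWeight, Finset.mul_sum]
  rw [hw, ← hc, div_mul_eq_mul_div, le_div_iff_of_neg hu] at hopt
  rcases hc0.eq_or_lt with h0 | hpos
  · refine hno ⟨0, ⟨fun _ => le_rfl, fun i j => by simp⟩, fun α h => absurd rfl h, ?_⟩
    simp [plexWeight, ← h0]
  · exact absurd (le_of_mul_le_mul_left hopt hpos) hsum.not_ge

/-- Every hyperplane of positive weight in an optimal cover meets an index covered exactly. -/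
theorem IsOptimalCover.exists_tight {d n : ℕ} {A : (Fin d → Fin n) → ℝ}
    {Λ : Fin d → Fin n → ℝ} (hΛ : IsOptimalCover A Λ) {i : Fin d} {j : Fin n}
    (hpos : 0 < Λ i j) :
    ∃ α : Fin d → Fin n, α i = j ∧ ∑ k, Λ k (α k) = 1 := by
  by_contra! hno
  have hslack : ∀ α : Fin d → Fin n, α i = j → A α ≠ 0 → 1 < ∑ k, Λ k (α k) :=
    fun α h hA => lt_of_le_of_ne (hΛ.1.2 α hA) (hno α h).symm
  obtain ⟨ε, hε, hεj, hεα⟩ : ∃ ε > 0, ε ≤ Λ i j ∧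
      ∀ α : Fin d → Fin n, α i = j → A α ≠ 0 → 1 + ε ≤ ∑ k, Λ k (α k) := by
    have hev : ∀ᶠ ε in nhdsWithin (0 : ℝ) (Set.Ioi 0), ε ≤ Λ i j ∧
        ∀ α : Fin d → Fin n, α i = j → A α ≠ 0 → 1 + ε ≤ ∑ k, Λ k (α k) := by
      refine Filter.Eventually.filter_mono nhdsWithin_le_nhds ?_
      refine (eventually_le_nhds hpos).and (Filter.eventually_all.2 fun α => ?_)
      refine Filter.eventually_imp_distrib_left.2 fun h =>
        Filter.eventually_imp_distrib_left.2 fun hA => ?_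
      filter_upwards [eventually_le_nhds (sub_pos.2 (hslack α h hA))] with ε hε
      linarith
    obtain ⟨ε, hε, hε'⟩ := (hev.and self_mem_nhdsWithin).exists
    exact ⟨ε, hε', hε⟩
  let P : Fin d → Fin n → ℝ := Pi.single i (Pi.single j ε)
  have hP : ∀ k m, P k m = if k = i then (if m = j then ε else 0) else 0 := by
    intro k m
    simp only [P, Pi.single_apply, ite_apply, Pi.zero_apply]
  have hcover : IsCover A (Λ - P) := by
    refine ⟨fun k m => ?_, fun α hA => ?_⟩
    · simp only [Pi.sub_apply, hP]
      split_ifs with h h'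
      · subst h h'
        linarith
      all_goals simpa using hΛ.1.1 k m
    · simp only [Pi.sub_apply, hP, Finset.sum_sub_distrib, Finset.sum_ite_eq', Finset.mem_univ,
        if_true]
      split_ifs with h
      · linarith [hεα α h hA]
      · simpa using hΛ.1.2 α hA
  have hw : coverWeight (Λ - P) = coverWeight Λ - ε := by
    simp [coverWeight, hP, Finset.sum_sub_distrib]
  linarith [hΛ.2 _ hcover]

/-- In an optimal cover of an extremal matrix, a strictly larger entry of a row exceeds
a smaller one by at least the deficiency. -/
theorem IsOptimalCover.deficiency_le_sub {d n : ℕ} {A : (Fin d → Fin n) → ℝ}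
    (hE : IsExtremal A) {δ : ℝ} (hδ : HasDeficiency A δ)
    {Λ : Fin d → Fin n → ℝ} (hΛ : IsOptimalCover A Λ) {i : Fin d} {j l : Fin n}
    (hlt : Λ i l < Λ i j) : δ ≤ Λ i j - Λ i l := by
  obtain ⟨α, hαi, hα⟩ := hΛ.exists_tight ((hΛ.1.1 i l).trans_lt hlt)
  set β := Function.update α i l with hβ
  have hsumβ : ∑ k, Λ k (β k) = 1 - (Λ i j - Λ i l) := by
    rw [← hα, ← Finset.add_sum_erase univ (fun k => Λ k (β k)) (Finset.mem_univ i),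
      ← Finset.add_sum_erase univ (fun k => Λ k (α k)) (Finset.mem_univ i)]
    have : ∑ k ∈ univ.erase i, Λ k (β k) = ∑ k ∈ univ.erase i, Λ k (α k) :=
      Finset.sum_congr rfl fun k hk => by
        rw [hβ, Function.update_of_ne (Finset.ne_of_mem_erase hk)]
    rw [this, hβ, Function.update_self, hαi]
    ring
  have hAβ : A β = 0 := by
    by_contra h
    linarith [hΛ.1.2 β h]
  obtain ⟨K, hK, hKA, hKn⟩ := hE.2 β hAβ
  have hKβ : K β ≤ 1 := by
    refine le_trans ?_ (hK.2 i (β i))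
    simpa using Finset.single_le_sum (f := fun γ => if γ i = β i then K γ else 0)
      (fun γ _ => by
        split_ifs
        exacts [hK.1 γ, le_rfl]) (Finset.mem_univ β)
  have hlow : (n : ℝ) - (Λ i j - Λ i l) ≤ ∑ γ, K γ * ∑ k, Λ k (γ k) := by
    have : ∑ γ, (K γ - if γ = β then Λ i j - Λ i l else 0) = n - (Λ i j - Λ i l) := by
      rw [Finset.sum_sub_distrib, ← hKn]
      simp [plexWeight]
    rw [← this]
    refine Finset.sum_le_sum fun γ _ => ?_
    split_ifs with h
    · rw [h, hsumβ]
      nlinarith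
    · rw [sub_zero]
      by_cases h0 : K γ = 0
      · simp [h0]
      · have := hKA γ h0
        rw [Function.update_of_ne h] at this
        exact le_mul_of_one_le_right (hK.1 γ) (hΛ.1.2 γ this)
  have hup := hδ.2 hΛ.coverWeight_mem_polyplexWeights
  linarith [sum_mul_cover_le_coverWeight hK hΛ.1.1]

/-- two non-equal entries in the same row of an optimal cover
differ by at least δ. -/
theorem stmt_8 (d n : ℕ) (A : (Fin d → Fin n) → ℝ) (hA : IsZeroOne A)
    (hE : IsExtremal A) (δ : ℝ) (hδ : HasDeficiency A δ)
    (Λ : Fin d → Fin n → ℝ) (hΛ : IsOptimalCover A Λ) :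
    ∀ (i : Fin d) (j l : Fin n), Λ i j ≠ Λ i l → δ ≤ |Λ i j - Λ i l| := by
  intro i j l hne
  rcases hne.lt_or_gt with h | h
  · rw [abs_sub_comm]
    exact (hΛ.deficiency_le_sub hE hδ h).trans (le_abs_self _)
  · exact (hΛ.deficiency_le_sub hE hδ h).trans (le_abs_self _)
end

section
/- Let m, d, n be positive integers with m < d, and let Λ be a d×n table all of whose entries lie in {0, 1/m}, whose weight equals n − 1/m, and each of whose rows contains at least one zero entry. Then A(Λ) is an extremal d-dimensional matrix of order n with deficiency 1/m, and Λ is its unique optimal hyperplane cover. -/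
open Finset

/-- The number of coordinates of `α` selected by the family of sets `S`. -/
def hitCount {d n : ℕ} (S : Fin d → Finset (Fin n)) (α : Fin d → Fin n) : ℕ :=
  #{i | α i ∈ S i}

lemma hitCount_eq_sum {d n : ℕ} (S : Fin d → Finset (Fin n)) (α : Fin d → Fin n) :
    hitCount S α = ∑ i, ∑ j ∈ S i, if α i = j then 1 else 0 := by
  rw [hitCount, Finset.card_filter]
  refine Finset.sum_congr rfl fun i _ => ?_
  rw [Finset.sum_ite_eq]

/-- A nonnegative integer table with constant row sums `N` and total mass `m * N` on `S` is the
table of hyperplane sums of a nonnegative integer matrix supported on indices that meet `S` in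
exactly `m` coordinates. -/
lemma exists_matrix_of_table {d n : ℕ} (S : Fin d → Finset (Fin n)) (m N : ℕ)
    (R : Fin d → Fin n → ℕ) (hrow : ∀ i, ∑ j, R i j = N)
    (hS : ∑ i, ∑ j ∈ S i, R i j = m * N) :
    ∃ K : (Fin d → Fin n) → ℕ, (∀ β, K β ≠ 0 → hitCount S β = m) ∧
      ∀ i j, (∑ β, if β i = j then K β else 0) = R i j := by
  induction N generalizing R with
  | zero =>
    refine ⟨fun _ => 0, fun β h => absurd rfl h, fun i j => ?_⟩
    have := hrow i
    rw [Finset.sum_eq_zero_iff] at this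
    simp [this j (mem_univ j)]
  | succ N ih =>
    have hle (i : Fin d) : ∑ j ∈ S i, R i j ≤ N + 1 :=
      (hrow i) ▸ Finset.sum_le_sum_of_subset (subset_univ _)
    obtain ⟨T, hFT, hTP, hT⟩ : ∃ T : Finset (Fin d),
        ({i | ∑ j ∈ S i, R i j = N + 1} : Finset (Fin d)) ⊆ T ∧
        T ⊆ ({i | 0 < ∑ j ∈ S i, R i j} : Finset (Fin d)) ∧ #T = m := by
      apply Finset.exists_subsuperset_card_eq
      · intro i hi
        simp only [mem_filter, mem_univ, true_and] at hi ⊢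
        omega
      · have h : ∑ i ∈ ({i | ∑ j ∈ S i, R i j = N + 1} : Finset (Fin d)), ∑ j ∈ S i, R i j
            = #{i | ∑ j ∈ S i, R i j = N + 1} * (N + 1) := by
          rw [Finset.sum_const_nat]
          intro i hi
          simpa using hi
        refine Nat.le_of_mul_le_mul_right ?_ (Nat.succ_pos N)
        rw [Nat.succ_eq_add_one, ← h, ← hS]
        exact Finset.sum_le_sum_of_subset (subset_univ _)
      · refine Nat.le_of_mul_le_mul_right ?_ (Nat.succ_pos N)
        rw [Nat.succ_eq_add_one, ← hS, ← smul_eq_mul]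
        rw [← Finset.sum_filter_of_ne (p := fun i => 0 < ∑ j ∈ S i, R i j)
          (fun i _ h => Nat.pos_of_ne_zero h)]
        exact Finset.sum_le_card_nsmul _ _ _ fun i _ => hle i
    have hex (i : Fin d) : ∃ j, 0 < R i j ∧ (j ∈ S i ↔ i ∈ T) := by
      by_cases hi : i ∈ T
      · have h := hTP hi
        simp only [mem_filter, mem_univ, true_and] at h
        obtain ⟨j, hj, hR⟩ := Finset.exists_ne_zero_of_sum_ne_zero h.ne'
        exact ⟨j, Nat.pos_of_ne_zero hR, by simp [hi, hj]⟩
      · have h : ∑ j ∈ S i, R i j ≠ N + 1 := fun h => hi (hFT (by simpa using h))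
        have h2 := Finset.sum_add_sum_compl (S i) (R i)
        rw [hrow i] at h2
        have h3 := hle i
        obtain ⟨j, hj, hR⟩ := Finset.exists_ne_zero_of_sum_ne_zero
          (show ∑ j ∈ (S i)ᶜ, R i j ≠ 0 by omega)
        exact ⟨j, Nat.pos_of_ne_zero hR, by simpa [hi] using hj⟩
    choose β hβ hβT using hex
    have hβm : hitCount S β = m := by
      rw [← hT, hitCount]
      congr 1
      ext i
      simp [hβT]
    have hR (i : Fin d) (j : Fin n) :
        (R i j - if β i = j then 1 else 0) + (if β i = j then 1 else 0) = R i j := by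
      split_ifs with h
      · subst h
        have := hβ i
        omega
      · rfl
    obtain ⟨K, hK, hKR⟩ := ih (fun i j => R i j - if β i = j then 1 else 0)
      (fun i => by
        have h := hrow i
        rw [Finset.sum_congr rfl fun j _ => (hR i j).symm, Finset.sum_add_distrib] at h
        simpa using h)
      (by
        have h := hS
        rw [Finset.sum_congr rfl fun i _ => Finset.sum_congr rfl fun j _ => (hR i j).symm] at h
        simp_rw [Finset.sum_add_distrib] at h
        rw [← hitCount_eq_sum, hβm, mul_add, mul_one] at h
        exact Nat.add_right_cancel h)
    refine ⟨fun γ => K γ + if γ = β then 1 else 0, fun γ hγ => ?_, fun i j => ?_⟩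
    · by_cases h : γ = β
      · rw [h, hβm]
      · exact hK γ (by simpa [h] using hγ)
    · rw [← hR i j, ← hKR i j]
      simp_rw [← Finset.sum_filter, Finset.sum_add_distrib]
      congr 1
      rw [Finset.sum_filter]
      have (γ : Fin d → Fin n) : (if γ i = j then (if γ = β then 1 else 0) else 0)
          = if γ = β then (if β i = j then 1 else 0) else 0 := by
        by_cases h : γ = β <;> simp [h]
      simp [this]

/-- If `S` has `m * n - 1` cells and misses a cell in each row, then every index meeting `S` in
fewer than `m` coordinates completes a matrix supported on indices meeting `S` in exactly `m`
coordinates to a matrix with constant hyperplane sums. -/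
lemma exists_matrix_completed_by {d n : ℕ} (S : Fin d → Finset (Fin n)) (m : ℕ)
    (hn : 0 < n) (hS : ∑ i, #(S i) + 1 = m * n) (α : Fin d → Fin n) (hα : hitCount S α < m) :
    ∃ K : (Fin d → Fin n) → ℕ, (∀ β, K β ≠ 0 → hitCount S β = m) ∧
      ∀ i j, (∑ β, if β i = j then K β else 0) + (if α i = j then 1 else 0)
        = m - hitCount S α := by
  obtain ⟨q, hq⟩ : ∃ q, m = hitCount S α + q + 1 :=
    ⟨m - hitCount S α - 1, by omega⟩
  have hmk : m - hitCount S α = q + 1 := by omega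
  have hR (i : Fin d) (j : Fin n) :
      (q + 1 - if α i = j then 1 else 0) + (if α i = j then 1 else 0) = q + 1 := by
    split_ifs <;> simp
  obtain ⟨K, hK, hKR⟩ := exists_matrix_of_table S m (n * (q + 1) - 1)
    (fun i j => q + 1 - if α i = j then 1 else 0)
    (fun i => by
      have h : ∑ j, ((q + 1 - if α i = j then 1 else 0) + (if α i = j then 1 else 0))
          = n * (q + 1) := by simp [hR]
      rw [Finset.sum_add_distrib] at h
      simp only [Finset.sum_ite_eq, mem_univ, if_true] at h
      omega)
    (by
      have h : ∑ i, ∑ j ∈ S i,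
          ((q + 1 - if α i = j then 1 else 0) + (if α i = j then 1 else 0))
          = (∑ i, #(S i)) * (q + 1) := by simp [hR, Finset.sum_mul]
      simp_rw [Finset.sum_add_distrib] at h
      rw [← hitCount_eq_sum] at h
      obtain ⟨N, hN⟩ : ∃ N, n * (q + 1) = N + 1 :=
        ⟨n * (q + 1) - 1, (Nat.succ_pred_eq_of_pos (by positivity)).symm⟩
      rw [hN, Nat.add_sub_cancel]
      have h1 : (∑ i, #(S i)) * (q + 1) + (q + 1) = m * N + m := by
        rw [← mul_add_one m, ← hN, ← mul_assoc, ← hS]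
        ring
      rw [← h] at h1
      omega)
  exact ⟨K, hK, fun i j => by rw [hKR, hR, hmk]⟩

/-- Pairing a matrix with the index sums of a table gives the pairing of the table with the
hyperplane sums. -/
lemma sum_mul_sum_table {d n : ℕ} (K : (Fin d → Fin n) → ℝ) (L : Fin d → Fin n → ℝ) :
    ∑ β, K β * ∑ i, L i (β i) = ∑ i, ∑ j, L i j * ∑ β, if β i = j then K β else 0 := by
  simp_rw [Finset.mul_sum]
  rw [Finset.sum_comm]
  refine Finset.sum_congr rfl fun i _ => ?_
  rw [Finset.sum_comm]
  refine Finset.sum_congr rfl fun β _ => ?_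
  simp [mul_comm]

lemma sum_hyperplane_sums {d n : ℕ} (K : (Fin d → Fin n) → ℝ) (i : Fin d) :
    ∑ j, (∑ β, if β i = j then K β else 0) = ∑ β, K β := by
  rw [Finset.sum_comm]
  simp

lemma plexWeight_le_coverWeight {d n : ℕ} {A K : (Fin d → Fin n) → ℝ} {L : Fin d → Fin n → ℝ}
    (hK : IsPolyplex K) (hKA : ContainedIn K A) (hL : IsCover A L) :
    plexWeight K ≤ coverWeight L := by
  calc plexWeight K ≤ ∑ β, K β * ∑ i, L i (β i) := by
        refine Finset.sum_le_sum fun β _ => ?_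
        by_cases h : K β = 0
        · simp [h]
        · exact le_mul_of_one_le_right (hK.1 β) (hL.2 β (hKA β h))
    _ = ∑ i, ∑ j, L i j * ∑ β, if β i = j then K β else 0 := sum_mul_sum_table K L
    _ ≤ coverWeight L := Finset.sum_le_sum fun i _ => Finset.sum_le_sum fun j _ =>
        mul_le_of_le_one_right (hL.1 i j) (hK.2 i j)

/-- Real-valued form of `exists_matrix_completed_by`, normalised to hyperplane sums one. -/
lemma exists_polyplex_completed_by {d n : ℕ} (S : Fin d → Finset (Fin n)) (m : ℕ)
    (hn : 0 < n) (hS : ∑ i, #(S i) + 1 = m * n) (α : Fin d → Fin n) (hα : hitCount S α < m) :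
    ∃ K : (Fin d → Fin n) → ℝ, (∀ β, 0 ≤ K β) ∧ (∀ β, K β ≠ 0 → hitCount S β = m) ∧
      ∀ i j, (∑ β, if β i = j then K β else 0)
        + (if α i = j then 1 / ((m : ℝ) - hitCount S α) else 0) = 1 := by
  obtain ⟨K, hK, hKR⟩ := exists_matrix_completed_by S m hn hS α hα
  have hpos : (0 : ℝ) < (m : ℝ) - hitCount S α := sub_pos.2 (by exact_mod_cast hα)
  refine ⟨fun β => (K β : ℝ) / ((m : ℝ) - hitCount S α), fun β => by positivity,
    fun β hβ => hK β fun h => hβ (by simp [h]), fun i j => ?_⟩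
  have h := congrArg (Nat.cast : ℕ → ℝ) (hKR i j)
  rw [Nat.cast_sub hα.le] at h
  push_cast at h
  have h' := congrArg (· / ((m : ℝ) - hitCount S α)) h
  simpa only [div_self hpos.ne', add_div, Finset.sum_div, ite_div, zero_div] using h'

/-- Index sums of the table equal to `1 / m` on `S` and zero elsewhere. -/
lemma sum_eq_hitCount_div {d n : ℕ} {S : Fin d → Finset (Fin n)} {m : ℕ}
    {L : Fin d → Fin n → ℝ} (hL : ∀ i j, L i j = if j ∈ S i then 1 / (m : ℝ) else 0)
    (α : Fin d → Fin n) : ∑ i, L i (α i) = (hitCount S α : ℝ) / m := by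
  simp_rw [hL, ← Finset.sum_filter, Finset.sum_const, nsmul_eq_mul, hitCount]
  ring

lemma matOf_ne_zero_iff {d n : ℕ} {S : Fin d → Finset (Fin n)} {m : ℕ} (hm : 0 < m)
    {L : Fin d → Fin n → ℝ} (hL : ∀ i j, L i j = if j ∈ S i then 1 / (m : ℝ) else 0)
    (α : Fin d → Fin n) : matOf L α ≠ 0 ↔ m ≤ hitCount S α := by
  have hm' : (0 : ℝ) < m := by exact_mod_cast hm
  simp [matOf, sum_eq_hitCount_div hL, one_le_div hm']

lemma isCover_matOf {d n : ℕ} {L : Fin d → Fin n → ℝ} (hL : ∀ i j, 0 ≤ L i j) :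
    IsCover (matOf L) L :=
  ⟨hL, fun α h => by by_contra h'; exact h (if_neg h')⟩

lemma exists_index_through {d n : ℕ} {S : Fin d → Finset (Fin n)} (hzero : ∀ i, ∃ j, j ∉ S i)
    (i : Fin d) (j : Fin n) :
    ∃ α : Fin d → Fin n, α i = j ∧ ∀ i', i' ≠ i → α i' ∉ S i' := by
  choose z hz using hzero
  exact ⟨Function.update z i j, by simp, fun i' h => by simpa [h] using hz i'⟩

lemma hitCount_eq_ite {d n : ℕ} {S : Fin d → Finset (Fin n)} {α : Fin d → Fin n} (i : Fin d)
    (h : ∀ i', i' ≠ i → α i' ∉ S i') : hitCount S α = if α i ∈ S i then 1 else 0 := by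
  rw [hitCount, Finset.card_filter]
  exact Finset.sum_eq_single i (fun i' _ hi' => if_neg (h i' hi')) (by simp)

/-- A table of weight `n - 1 / m` covering all indices that meet `S` in exactly `m` coordinates
has index sum at most `k / m` on every index that meets `S` in `k < m` coordinates. -/
lemma sum_le_hitCount_div {d n : ℕ} (S : Fin d → Finset (Fin n)) (m : ℕ) (hd : 0 < d)
    (hn : 0 < n) (hS : ∑ i, #(S i) + 1 = m * n) {L : Fin d → Fin n → ℝ}
    (hcover : ∀ β, hitCount S β = m → 1 ≤ ∑ i, L i (β i))
    (hw : coverWeight L = (n : ℝ) - 1 / (m : ℝ)) (α : Fin d → Fin n) (hα : hitCount S α < m) :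
    ∑ i, L i (α i) ≤ (hitCount S α : ℝ) / m := by
  obtain ⟨K, hK0, hK, hKR⟩ := exists_polyplex_completed_by S m hn hS α hα
  have hpos : (0 : ℝ) < (m : ℝ) - hitCount S α := sub_pos.2 (by exact_mod_cast hα)
  have hm : (0 : ℝ) < m := by exact_mod_cast (Nat.zero_le _).trans_lt hα
  set t : ℝ := 1 / ((m : ℝ) - hitCount S α) with ht
  have htpos : 0 < t := by positivity
  have hKs (i : Fin d) (j : Fin n) :
      (∑ β, if β i = j then K β else 0) = 1 - if α i = j then t else 0 :=
    eq_sub_of_add_eq (hKR i j)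
  have hsum : ∑ β, K β = n - t := by
    rw [← sum_hyperplane_sums K ⟨0, hd⟩]
    simp [hKs]
  have hpair := sum_mul_sum_table K L
  simp_rw [hKs, mul_sub, Finset.sum_sub_distrib, mul_one] at hpair
  simp only [mul_ite, mul_zero, Finset.sum_ite_eq, mem_univ, if_true] at hpair
  rw [← Finset.sum_mul] at hpair
  change _ = coverWeight L - _ at hpair
  have hle : ∑ β, K β ≤ ∑ β, K β * ∑ i, L i (β i) := by
    refine Finset.sum_le_sum fun β _ => ?_
    by_cases h : K β = 0
    · simp [h]
    · exact le_mul_of_one_le_right (hK0 β) (hcover β (hK β h))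
  rw [hpair, hsum, hw] at hle
  have h1 : (∑ i, L i (α i)) * t ≤ t - 1 / m := by linarith
  have h2 : t - 1 / m = (hitCount S α : ℝ) / m * t := by
    rw [ht]
    field_simp
    ring
  rw [h2] at h1
  exact le_of_mul_le_mul_right h1 htpos

/-- a two-value table of weight n − 1/m with a zero in each row
defines an extremal matrix with unique optimal cover. -/
theorem stmt_15 (m d n : ℕ) (hm : 0 < m) (hmd : m < d) (hn : 0 < n)
    (Λ : Fin d → Fin n → ℝ)
    (hval : ∀ i j, Λ i j = 0 ∨ Λ i j = 1 / (m : ℝ))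
    (hw : coverWeight Λ = (n : ℝ) - 1 / (m : ℝ))
    (hzero : ∀ i : Fin d, ∃ j : Fin n, Λ i j = 0) :
    IsExtremal (matOf Λ) ∧
    HasDeficiency (matOf Λ) (1 / (m : ℝ)) ∧
    IsOptimalCover (matOf Λ) Λ ∧
    ∀ Λ' : Fin d → Fin n → ℝ, IsOptimalCover (matOf Λ) Λ' → Λ' = Λ := by
  classical
  have hd : 0 < d := hm.trans hmd
  have hm' : (0 : ℝ) < m := by exact_mod_cast hm
  set S : Fin d → Finset (Fin n) := fun i => {j | Λ i j ≠ 0}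
  have hΛ (i : Fin d) (j : Fin n) : Λ i j = if j ∈ S i then 1 / (m : ℝ) else 0 := by
    have := hval i j
    by_cases h : Λ i j = 0 <;> simp_all [S]
  have hzS (i : Fin d) : ∃ j, j ∉ S i := by
    obtain ⟨j, hj⟩ := hzero i
    exact ⟨j, by simp [S, hj]⟩
  have hS : ∑ i, #(S i) + 1 = m * n := by
    have h : ((∑ i, #(S i) : ℕ) : ℝ) / m = n - 1 / m := by
      rw [← hw, coverWeight]
      simp_rw [hΛ]
      simp [div_eq_mul_inv, Finset.sum_mul]
    field_simp at h
    have h' : ((∑ i, #(S i) : ℕ) : ℝ) + 1 = m * n := by linarith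
    exact_mod_cast h'
  have hsupp := matOf_ne_zero_iff hm hΛ
  have hnonneg (i : Fin d) (j : Fin n) : 0 ≤ Λ i j := by
    rw [hΛ]
    positivity
  have hcov : IsCover (matOf Λ) Λ := isCover_matOf hnonneg
  have hgreatest : HasDeficiency (matOf Λ) (1 / (m : ℝ)) := by
    constructor
    · choose z hz using hzS
      have hz0 : hitCount S z = 0 := by simp [hitCount, hz]
      obtain ⟨K, hK0, hK, hKR⟩ := exists_polyplex_completed_by S m hn hS z (by omega)
      rw [hz0, Nat.cast_zero, sub_zero] at hKR
      have hKs (i : Fin d) (j : Fin n) : (∑ β, if β i = j then K β else 0)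
          = 1 - if z i = j then 1 / (m : ℝ) else 0 := eq_sub_of_add_eq (hKR i j)
      refine ⟨K, ⟨hK0, fun i j => ?_⟩, fun β h => (hsupp β).2 (hK β h).ge, ?_⟩
      · rw [hKs, sub_le_self_iff]
        positivity
      · rw [plexWeight, ← sum_hyperplane_sums K ⟨0, hd⟩]
        simp [hKs]
    · rintro W ⟨K, hK, hKA, rfl⟩
      rw [← hw]
      exact plexWeight_le_coverWeight hK hKA hcov
  have hlower (L : Fin d → Fin n → ℝ) (hL : IsCover (matOf Λ) L) :
      (n : ℝ) - 1 / m ≤ coverWeight L := by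
    obtain ⟨K, hK, hKA, hKw⟩ := hgreatest.1
    rw [← hKw]
    exact plexWeight_le_coverWeight hK hKA hL
  refine ⟨⟨?_, fun α hα => ?_⟩, hgreatest, ⟨hcov, fun L hL => hw ▸ hlower L hL⟩,
    fun L hL => ?_⟩
  · intro h
    have h1 := hgreatest.2 h
    have h2 : 0 < 1 / (m : ℝ) := by positivity
    linarith
  · have hα' : hitCount S α < m := by
      by_contra! h
      exact (hsupp α).2 h hα
    obtain ⟨K, hK0, hK, hKR⟩ := exists_polyplex_completed_by S m hn hS α hα'
    have hpos : (0 : ℝ) < (m : ℝ) - hitCount S α := sub_pos.2 (by exact_mod_cast hα')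
    set t : ℝ := 1 / ((m : ℝ) - hitCount S α) with ht
    have htpos : 0 < t := by positivity
    have hsum (i : Fin d) (j : Fin n) :
        (∑ β, if β i = j then K β + (if β = α then t else 0) else 0) = 1 := by
      rw [← hKR i j]
      simp_rw [← Finset.sum_filter, Finset.sum_add_distrib]
      congr 1
      rw [Finset.sum_filter]
      have (γ : Fin d → Fin n) : (if γ i = j then (if γ = α then t else 0) else 0)
          = if γ = α then (if α i = j then t else 0) else 0 := by
        by_cases h : γ = α <;> simp [h]
      simp [this]
    refine ⟨fun β => K β + if β = α then t else 0,
      ⟨fun β => add_nonneg (hK0 β) (by positivity), fun i j => (hsum i j).le⟩,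
      fun β hβ => ?_, ?_⟩
    · by_cases h : β = α
      · simp [h]
      · rw [Function.update_of_ne h]
        exact (hsupp β).2 (hK β (by simpa [h] using hβ)).ge
    · rw [plexWeight, ← sum_hyperplane_sums _ ⟨0, hd⟩]
      simp [hsum]
  · have hLw : coverWeight L = (n : ℝ) - 1 / m :=
      le_antisymm (hw ▸ hL.2 Λ hcov) (hlower L hL.1)
    have hLle := sum_le_hitCount_div S m hd hn hS
      (fun β hβ => hL.1.2 β ((hsupp β).2 hβ.ge)) hLw
    have hterm (α : Fin d → Fin n) (i : Fin d) : L i (α i) ≤ ∑ i', L i' (α i') :=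
      Finset.single_le_sum (f := fun i' => L i' (α i')) (fun i' _ => hL.1.1 i' (α i'))
        (mem_univ i)
    have hoff (i : Fin d) (j : Fin n) (hj : j ∉ S i) : L i j = 0 := by
      obtain ⟨α, rfl, hα⟩ := exists_index_through hzS i j
      have hk := hitCount_eq_ite i hα
      rw [if_neg hj] at hk
      have h := hLle α (by omega)
      rw [hk, Nat.cast_zero, zero_div] at h
      exact le_antisymm ((hterm α i).trans h) (hL.1.1 _ _)
    have hcells : (∑ p : Fin d × Fin n, L p.1 p.2) = ∑ p : Fin d × Fin n, Λ p.1 p.2 := by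
      simp_rw [Fintype.sum_prod_type]
      exact hLw.trans hw.symm
    have hall : ∀ p ∈ (univ : Finset (Fin d × Fin n)), L p.1 p.2 = Λ p.1 p.2 := by
      rcases (Nat.succ_le_of_lt hm).eq_or_lt with h1 | h1
      · have hge : ∀ p ∈ (univ : Finset (Fin d × Fin n)), Λ p.1 p.2 ≤ L p.1 p.2 := by
          rintro ⟨i, j⟩ -
          rw [hΛ]
          split_ifs with hj
          · obtain ⟨α, rfl, hα⟩ := exists_index_through hzS i j
            have hk := hitCount_eq_ite i hα
            rw [if_pos hj] at hk
            have h := hL.1.2 α ((hsupp α).2 (by omega))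
            rw [Finset.sum_eq_single i (fun i' _ hi' => hoff i' _ (hα i' hi')) (by simp)] at h
            simpa [← h1] using h
          · exact hL.1.1 i j
        exact fun p hp => (((Finset.sum_eq_sum_iff_of_le hge).1 hcells.symm) p hp).symm
      · refine (Finset.sum_eq_sum_iff_of_le ?_).1 hcells
        rintro ⟨i, j⟩ -
        rw [hΛ]
        split_ifs with hj
        · obtain ⟨α, rfl, hα⟩ := exists_index_through hzS i j
          have hk := hitCount_eq_ite i hα
          rw [if_pos hj] at hk
          have h := hLle α (by omega)
          rw [hk, Nat.cast_one] at h
          exact (hterm α i).trans h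
        · exact (hoff i j hj).le
    funext i j
    exact hall (i, j) (mem_univ _)
end
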